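/- Let ω be continuously differentiable on [0,1] and θ > θ₀. Let U = U(·;θ) : [0, d(θ)] → [0,1] be the inverse of the strictly increasing function p ↦ H(p;θ) = ∫₀^p (θ² − 2Ω(τ))^{−1/2} dτ. Then U is twice continuously differentiable and strictly increasing, U(0) = 0, U(d(θ)) = 1, U′(Y) = √(θ² − 2Ω(U(Y))) for all Y ∈ [0, d(θ)] (in particular U′(0) = θ), U satisfies the equation U″(Y) + ω(U(Y)) = 0 on (0, d(θ)), and the Bernoulli boundary relation (1/2)·U′(d(θ))² + d(θ) = ℛ(θ) holds. -/

import Mathlib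

/-- `Omg ω τ = ∫₀^τ ω(s) ds`. -/
noncomputable def Omg (ω : ℝ → ℝ) (τ : ℝ) : ℝ := ∫ s in (0:ℝ)..τ, ω s

/-- `theta0 ω = √(2 · max_{τ∈[0,1]} Ω(τ))`. -/
noncomputable def theta0 (ω : ℝ → ℝ) : ℝ := Real.sqrt (2 * sSup (Omg ω '' Set.Icc 0 1))

/-- `Hfun ω θ p = ∫₀^p (θ² − 2Ω(τ))^{−1/2} dτ`. -/
noncomputable def Hfun (ω : ℝ → ℝ) (θ p : ℝ) : ℝ :=
  ∫ τ in (0:ℝ)..p, 1 / Real.sqrt (θ ^ 2 - 2 * Omg ω τ)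

/-- `dfun ω θ = H(1;θ)`. -/
noncomputable def dfun (ω : ℝ → ℝ) (θ : ℝ) : ℝ := Hfun ω θ 1

/-- `Rcal ω θ = θ²/2 + d(θ) − Ω(1)`. -/
noncomputable def Rcal (ω : ℝ → ℝ) (θ : ℝ) : ℝ := θ ^ 2 / 2 + dfun ω θ - Omg ω 1

open Set Filter Topology

lemma ContinuousOn.hasDerivWithinAt_integral_Icc {f : ℝ → ℝ} {a b : ℝ}
    (hf : ContinuousOn f (Icc a b)) {x : ℝ} (hx : x ∈ Icc a b) :
    HasDerivWithinAt (fun u => ∫ s in a..u, f s) (f x) (Icc a b) x := by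
  have := Fact.mk hx
  apply intervalIntegral.integral_hasDerivWithinAt_right
  · exact (hf.mono (Icc_subset_Icc le_rfl hx.2)).intervalIntegrable_of_Icc hx.1
  · exact hf.stronglyMeasurableAtFilter_nhdsWithin measurableSet_Icc x
  · exact hf.continuousWithinAt hx

lemma HasDerivWithinAt.of_local_left_inverse {f g : ℝ → ℝ} {f' a : ℝ} {s t : Set ℝ}
    (hg : Tendsto g (𝓝[s] a) (𝓝[t] (g a))) (hf : HasDerivWithinAt f f' t (g a)) (hf' : f' ≠ 0)
    (ha : a ∈ s) (hfg : ∀ᶠ x in 𝓝[s] a, f (g x) = x) : HasDerivWithinAt g f'⁻¹ s a :=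
  HasFDerivWithinAt.of_local_left_inverse
    (f' := ContinuousLinearEquiv.unitsEquivAut ℝ (Units.mk0 f' hf')) hg hf ha hfg

lemma IsCompact.continuousOn_of_invOn {f g : ℝ → ℝ} {s t : Set ℝ} (hs : IsCompact s)
    (hf : ContinuousOn f s) (hinv : InvOn g f s t) (hg : MapsTo g t s) : ContinuousOn g t := by
  refine continuousOn_iff_isClosed.2 fun C hC =>
    ⟨f '' (s ∩ C), ((hs.inter_right hC).image_of_continuousOn
      (hf.mono inter_subset_left)).isClosed, ?_⟩
  ext y
  constructor
  · rintro ⟨hyC, hy⟩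
    exact ⟨⟨g y, ⟨hg hy, hyC⟩, hinv.2 hy⟩, hy⟩
  · rintro ⟨⟨x, ⟨hx, hxC⟩, rfl⟩, hy⟩
    exact ⟨by rwa [mem_preimage, hinv.1 hx], hy⟩

lemma strictMonoOn_Icc_of_hasDerivWithinAt_pos {f f' : ℝ → ℝ} {a b : ℝ}
    (hf : ∀ x ∈ Icc a b, HasDerivWithinAt f (f' x) (Icc a b) x)
    (hf' : ∀ x ∈ Icc a b, 0 < f' x) : StrictMonoOn f (Icc a b) := by
  refine strictMonoOn_of_deriv_pos (convex_Icc a b)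
    (fun x hx => (hf x hx).continuousWithinAt) fun x hx => ?_
  have hx' := interior_subset hx
  rw [((hf x hx').hasDerivAt (mem_interior_iff_mem_nhds.1 hx)).deriv]
  exact hf' x hx'

/-- If `U' = g` and `g' = k` on a nondegenerate interval, with `k` continuous, then `U` is `C²`. -/
lemma contDiffOn_two_Icc_of_hasDerivWithinAt {U g k : ℝ → ℝ} {a b : ℝ} (hab : a < b)
    (hU : ∀ x ∈ Icc a b, HasDerivWithinAt U (g x) (Icc a b) x)
    (hg : ∀ x ∈ Icc a b, HasDerivWithinAt g (k x) (Icc a b) x)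
    (hk : ContinuousOn k (Icc a b)) : ContDiffOn ℝ 2 U (Icc a b) := by
  have hu := uniqueDiffOn_Icc hab
  rw [show (2 : WithTop ℕ∞) = 1 + 1 by norm_num, contDiffOn_succ_iff_derivWithin hu]
  refine ⟨fun x hx => (hU x hx).differentiableWithinAt, by simp, ?_⟩
  refine ContDiffOn.congr ?_ fun x hx => (hU x hx).derivWithin (hu x hx)
  rw [contDiffOn_one_iff_derivWithin hu]
  exact ⟨fun x hx => (hg x hx).differentiableWithinAt,
    hk.congr fun x hx => (hg x hx).derivWithin (hu x hx)⟩

lemma Omg_zero (ω : ℝ → ℝ) : Omg ω 0 = 0 := by simp [Omg]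

lemma Hfun_zero (ω : ℝ → ℝ) (θ : ℝ) : Hfun ω θ 0 = 0 := by simp [Hfun]

section

variable {ω : ℝ → ℝ} {θ : ℝ}

lemma hasDerivWithinAt_Omg (hω : ContinuousOn ω (Icc 0 1)) {p : ℝ} (hp : p ∈ Icc (0 : ℝ) 1) :
    HasDerivWithinAt (Omg ω) (ω p) (Icc 0 1) p :=
  hω.hasDerivWithinAt_integral_Icc hp

lemma continuousOn_Omg (hω : ContinuousOn ω (Icc 0 1)) : ContinuousOn (Omg ω) (Icc 0 1) :=
  fun _ hp => (hasDerivWithinAt_Omg hω hp).continuousWithinAt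

lemma theta0_nonneg (ω : ℝ → ℝ) : 0 ≤ theta0 ω := Real.sqrt_nonneg _

lemma sq_sub_two_mul_Omg_pos (hω : ContinuousOn ω (Icc 0 1)) (hθ : theta0 ω < θ) {p : ℝ}
    (hp : p ∈ Icc (0 : ℝ) 1) : 0 < θ ^ 2 - 2 * Omg ω p := by
  have hmax : Omg ω p ≤ sSup (Omg ω '' Icc 0 1) :=
    le_csSup (isCompact_Icc.image_of_continuousOn (continuousOn_Omg hω)).bddAbove
      (mem_image_of_mem _ hp)
  have := Real.lt_sq_of_sqrt_lt hθ
  linarith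

lemma hasDerivWithinAt_Hfun (hω : ContinuousOn ω (Icc 0 1)) (hθ : theta0 ω < θ) {p : ℝ}
    (hp : p ∈ Icc (0 : ℝ) 1) :
    HasDerivWithinAt (Hfun ω θ) (1 / √(θ ^ 2 - 2 * Omg ω p)) (Icc 0 1) p := by
  refine ContinuousOn.hasDerivWithinAt_integral_Icc
    (f := fun τ => 1 / √(θ ^ 2 - 2 * Omg ω τ)) ?_ hp
  exact continuousOn_const.div
    (continuousOn_const.sub (continuousOn_const.mul (continuousOn_Omg hω))).sqrt
    fun τ hτ => (Real.sqrt_pos.2 (sq_sub_two_mul_Omg_pos hω hθ hτ)).ne'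

lemma strictMonoOn_Hfun (hω : ContinuousOn ω (Icc 0 1)) (hθ : theta0 ω < θ) :
    StrictMonoOn (Hfun ω θ) (Icc 0 1) :=
  strictMonoOn_Icc_of_hasDerivWithinAt_pos (fun _ hp => hasDerivWithinAt_Hfun hω hθ hp)
    fun _ hp => one_div_pos.2 (Real.sqrt_pos.2 (sq_sub_two_mul_Omg_pos hω hθ hp))

end

/-- properties of the uniform stream profile `U`, the inverse of `H(·;θ)`. -/
theorem stmt1 (ω : ℝ → ℝ) (hω : ContDiffOn ℝ 1 ω (Set.Icc 0 1))
    (θ : ℝ) (hθ : theta0 ω < θ) (U : ℝ → ℝ)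
    (hUinv : Set.InvOn U (Hfun ω θ) (Set.Icc 0 1) (Set.Icc 0 (dfun ω θ)))
    (hUmaps : Set.MapsTo U (Set.Icc 0 (dfun ω θ)) (Set.Icc 0 1)) :
    ContDiffOn ℝ 2 U (Set.Icc 0 (dfun ω θ)) ∧
    StrictMonoOn U (Set.Icc 0 (dfun ω θ)) ∧
    U 0 = 0 ∧ U (dfun ω θ) = 1 ∧
    (∀ Y ∈ Set.Icc (0:ℝ) (dfun ω θ),
      HasDerivWithinAt U (Real.sqrt (θ ^ 2 - 2 * Omg ω (U Y))) (Set.Icc 0 (dfun ω θ)) Y) ∧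
    derivWithin U (Set.Icc 0 (dfun ω θ)) 0 = θ ∧
    (∀ Y ∈ Set.Ioo (0:ℝ) (dfun ω θ), deriv (deriv U) Y + ω (U Y) = 0) ∧
    (1/2) * (derivWithin U (Set.Icc 0 (dfun ω θ)) (dfun ω θ)) ^ 2 + dfun ω θ = Rcal ω θ := by
  have hc := hω.continuousOn
  have hpos {p : ℝ} (hp : p ∈ Icc (0 : ℝ) 1) := sq_sub_two_mul_Omg_pos hc hθ hp
  have h0 : (0 : ℝ) ∈ Icc (0 : ℝ) 1 := left_mem_Icc.2 zero_le_one
  have h1 : (1 : ℝ) ∈ Icc (0 : ℝ) 1 := right_mem_Icc.2 zero_le_one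
  have hHmono := strictMonoOn_Hfun hc hθ
  have hd : 0 < dfun ω θ := by
    simpa only [Hfun_zero] using! hHmono h0 h1 zero_lt_one
  have hU0 : U 0 = 0 := by simpa only [Hfun_zero] using hUinv.1 h0
  have hU1 : U (dfun ω θ) = 1 := hUinv.1 h1
  have hUcont : ContinuousOn U (Icc 0 (dfun ω θ)) := isCompact_Icc.continuousOn_of_invOn
    (fun p hp => (hasDerivWithinAt_Hfun hc hθ hp).continuousWithinAt) hUinv hUmaps
  have hU' : ∀ Y ∈ Icc (0 : ℝ) (dfun ω θ),
      HasDerivWithinAt U (√(θ ^ 2 - 2 * Omg ω (U Y))) (Icc 0 (dfun ω θ)) Y := by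
    intro Y hY
    have hne := (one_div_pos.2 (Real.sqrt_pos.2 (hpos (hUmaps hY)))).ne'
    have := HasDerivWithinAt.of_local_left_inverse
      ((hUcont Y hY).tendsto_nhdsWithin hUmaps)
      (hasDerivWithinAt_Hfun hc hθ (hUmaps hY)) hne hY
      (eventually_mem_nhdsWithin.mono fun Z hZ => hUinv.2 hZ)
    rwa [one_div, inv_inv] at this
  have hU'' : ∀ Y ∈ Icc (0 : ℝ) (dfun ω θ),
      HasDerivWithinAt (fun Z => √(θ ^ 2 - 2 * Omg ω (U Z))) (-ω (U Y)) (Icc 0 (dfun ω θ)) Y := by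
    intro Y hY
    have hp := hpos (hUmaps hY)
    have hΩ := ((((hasDerivWithinAt_Omg hc (hUmaps hY)).comp Y (hU' Y hY) hUmaps).const_mul
      2).const_sub (θ ^ 2)).sqrt hp.ne'
    refine hΩ.congr_deriv ?_
    have := (Real.sqrt_pos.2 hp).ne'
    simp only [Function.comp_apply]
    field_simp
  have hu := uniqueDiffOn_Icc hd
  have hd0 : (0 : ℝ) ∈ Icc 0 (dfun ω θ) := left_mem_Icc.2 hd.le
  have hd1 : dfun ω θ ∈ Icc 0 (dfun ω θ) := right_mem_Icc.2 hd.le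
  refine ⟨contDiffOn_two_Icc_of_hasDerivWithinAt hd hU' hU'' (hc.comp hUcont hUmaps).neg,
    strictMonoOn_Icc_of_hasDerivWithinAt_pos hU' fun Y hY => Real.sqrt_pos.2 (hpos (hUmaps hY)),
    hU0, hU1, hU', ?_, ?_, ?_⟩
  · rw [(hU' 0 hd0).derivWithin (hu 0 hd0), hU0, Omg_zero, mul_zero, sub_zero,
      Real.sqrt_sq ((theta0_nonneg ω).trans hθ.le)]
  · intro Y hY
    have hderiv : deriv U =ᶠ[𝓝 Y] fun Z => √(θ ^ 2 - 2 * Omg ω (U Z)) := by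
      filter_upwards [Ioo_mem_nhds hY.1 hY.2] with Z hZ
      exact ((hU' Z (Ioo_subset_Icc_self hZ)).hasDerivAt (Icc_mem_nhds hZ.1 hZ.2)).deriv
    rw [hderiv.deriv_eq, ((hU'' Y (Ioo_subset_Icc_self hY)).hasDerivAt
      (Icc_mem_nhds hY.1 hY.2)).deriv, neg_add_cancel]
  · rw [(hU' _ hd1).derivWithin (hu _ hd1), hU1, Real.sq_sqrt (hpos h1).le, Rcal]
    ring
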